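/- Fix n ≥ 2 and let σ : U → U be a ring homomorphism such that σ(E_j) = E_j for all j = 1, …, n and σ(c·1) = c̄·1 for every scalar c ∈ K, where c ↦ c̄ is the ℚ-algebra automorphism of K = ℚ(v) determined by v ↦ v^{−1}. Then for every i with 1 ≤ i ≤ n − 1 and every N ∈ ℕ: σ( E_{i,i+1}^{(N)} ) = Σ_{k=0}^{N} v^{ − k(k−1)/2 } · [k]_v! · (v^{−1} − v)^k · E_i^{(k)} E_{i,i+1}^{(N−k)} E_{i+1}^{(k)}. -/

import Mathlib

noncomputable section

/-- The base field `K = ℚ(v)`. -/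
abbrev K : Type := RatFunc ℚ

/-- The variable `v ∈ ℚ(v)`. -/
noncomputable def v : K := RatFunc.X

/-- The quantum integer `[k]_v = (v^k - v^{-k})/(v - v^{-1})`. -/
noncomputable def qint (k : ℕ) : K := (v ^ k - v⁻¹ ^ k) / (v - v⁻¹)

/-- The quantum factorial `[k]_v!`. -/
noncomputable def qfact : ℕ → K
  | 0 => 1
  | k + 1 => qint (k + 1) * qfact k

/-- The quantum binomial coefficient `binom(k, m)_v`. -/
noncomputable def qbinom (k m : ℕ) : K := qfact k / (qfact m * qfact (k - m))

/-- The defining relations of `U_v^+(sl_{n+1})`: commutation for distant indices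
and the quantum Serre relations for adjacent indices. -/
inductive SerreRel (n : ℕ) : FreeAlgebra K (Fin n) → FreeAlgebra K (Fin n) → Prop
  | comm (i j : Fin n) (h : (i : ℕ) + 1 < (j : ℕ)) :
      SerreRel n (FreeAlgebra.ι K i * FreeAlgebra.ι K j) (FreeAlgebra.ι K j * FreeAlgebra.ι K i)
  | serre (i j : Fin n) (h : (i : ℕ) + 1 = (j : ℕ) ∨ (j : ℕ) + 1 = (i : ℕ)) :
      SerreRel n (FreeAlgebra.ι K i ^ 2 * FreeAlgebra.ι K j + FreeAlgebra.ι K j * FreeAlgebra.ι K i ^ 2)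
        ((v + v⁻¹) • (FreeAlgebra.ι K i * FreeAlgebra.ι K j * FreeAlgebra.ι K i))

/-- The algebra `U = U_v^+(sl_{n+1})`, presented by generators `E_1, …, E_n` and the
quantum Serre relations. -/
abbrev Uq (n : ℕ) := RingQuot (SerreRel n)

/-- The Chevalley generator `E_i ∈ U` for `1 ≤ i ≤ n` (junk value `0` outside this range). -/
noncomputable def E (n : ℕ) (i : ℕ) : Uq n :=
  if h : i - 1 < n ∧ 1 ≤ i then
    RingQuot.mkAlgHom K (SerreRel n) (FreeAlgebra.ι K (⟨i - 1, h.1⟩ : Fin n)) else 0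

/-- The divided power `u^{(r)} = u^r / [r]_v!`. -/
noncomputable def dp (n : ℕ) (u : Uq n) (r : ℕ) : Uq n := (qfact r)⁻¹ • u ^ r

/-- The root vector `E_{i,i+1} = E_{i+1}E_i - v^{-1}E_iE_{i+1}`. -/
noncomputable def Ebr (n : ℕ) (i : ℕ) : Uq n :=
  E n (i + 1) * E n i - v⁻¹ • (E n i * E n (i + 1))

/-- The ordered product `g 1 * g 2 * ⋯ * g n` in `U`. -/
noncomputable def Eprod (n : ℕ) (g : ℕ → Uq n) : Uq n :=
  ((List.range n).map fun k => g (k + 1)).prod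

/-- Extension of a tuple `(x_1, …, x_{n-1})` (given as a function on `Fin (n-1)`)
to a function on `ℕ`, with the convention `x_k = 0` for `k = 0` and `k ≥ n`. -/
def tup (n : ℕ) (x : Fin (n - 1) → ℕ) (k : ℕ) : ℕ :=
  if h : k - 1 < n - 1 ∧ 1 ≤ k then x ⟨k - 1, h.1⟩ else 0


theorem v_ne_zero : v ≠ 0 := RatFunc.X_ne_zero

theorem v_pow_ne_one {k : ℕ} (hk : k ≠ 0) : v ^ k ≠ 1 := by
  intro h
  have h' : algebraMap (Polynomial ℚ) K (Polynomial.X ^ k) = algebraMap (Polynomial ℚ) K 1 := by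
    rw [map_pow, map_one, RatFunc.algebraMap_X]
    exact h
  have h'' := congrArg Polynomial.natDegree (RatFunc.algebraMap_injective ℚ h')
  rw [Polynomial.natDegree_X_pow, Polynomial.natDegree_one] at h''
  exact hk h''

theorem v_pow_sub_inv_pow_ne_zero {k : ℕ} (hk : k ≠ 0) : v ^ k - v⁻¹ ^ k ≠ 0 := by
  intro h
  apply v_pow_ne_one (k := k + k) (by omega)
  rw [pow_add]
  nth_rewrite 2 [sub_eq_zero.mp h]
  rw [← mul_pow, mul_inv_cancel₀ v_ne_zero, one_pow]

theorem v_sub_inv_ne_zero : v - v⁻¹ ≠ 0 := by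
  simpa using v_pow_sub_inv_pow_ne_zero one_ne_zero

theorem qint_zero : qint 0 = 0 := by simp [qint]

theorem qint_ne_zero {k : ℕ} (hk : k ≠ 0) : qint k ≠ 0 :=
  div_ne_zero (v_pow_sub_inv_pow_ne_zero hk) v_sub_inv_ne_zero

theorem qint_add (k m : ℕ) : qint (k + m) = v ^ k * qint m + v⁻¹ ^ m * qint k := by
  simp only [qint, pow_add]
  ring

theorem qfact_ne_zero (k : ℕ) : qfact k ≠ 0 := by
  induction k with
  | zero => exact one_ne_zero
  | succ k ih => exact mul_ne_zero (qint_ne_zero k.succ_ne_zero) ih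

theorem qint_succ_mul_qfact_succ_inv (k : ℕ) :
    qint (k + 1) * (qfact (k + 1))⁻¹ = (qfact k)⁻¹ := by
  rw [qfact, mul_inv, mul_inv_cancel_left₀ (qint_ne_zero k.succ_ne_zero)]

theorem bar_qint (bar : K →ₐ[ℚ] K) (hbar : bar v = v⁻¹) (k : ℕ) : bar (qint k) = qint k := by
  simp only [qint, map_div₀, map_sub, map_pow, map_inv₀, hbar, inv_inv]
  rw [← neg_sub (v ^ k), ← neg_sub v, neg_div_neg_eq]

theorem bar_qfact (bar : K →ₐ[ℚ] K) (hbar : bar v = v⁻¹) (k : ℕ) : bar (qfact k) = qfact k := by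
  induction k with
  | zero => exact map_one bar
  | succ k ih => rw [qfact, map_mul, bar_qint bar hbar, ih]

/-- The scalar `v^{-k(k-1)/2} (v⁻¹ - v)^k / [k]_v!`. -/
def barCoeff (k : ℕ) : K :=
  v ^ (-((k * (k - 1) / 2 : ℕ) : ℤ)) * (v⁻¹ - v) ^ k * (qfact k)⁻¹

theorem qint_succ_mul_barCoeff_succ (k : ℕ) :
    qint (k + 1) * barCoeff (k + 1) = (v⁻¹ - v) * v⁻¹ ^ k * barCoeff k := by
  have htri : v ^ (-(((k + 1) * (k + 1 - 1) / 2 : ℕ) : ℤ)) =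
      v ^ (-((k * (k - 1) / 2 : ℕ) : ℤ)) * v⁻¹ ^ k := by
    rw [Nat.triangle_succ, Nat.cast_add, neg_add, zpow_add₀ v_ne_zero, inv_pow,
      zpow_neg v (k : ℤ), zpow_natCast]
  rw [barCoeff, barCoeff, htri, ← qint_succ_mul_qfact_succ_inv k]
  ring

theorem sub_smul_eq_sub_smul_add {R A : Type*} [Ring R] [AddCommGroup A] [Module R A]
    (c d : R) (s t : A) : s - c • t = s - d • t + (d - c) • t := by
  rw [sub_smul]
  abel

section QCommutation

variable {A : Type*} [Ring A] [Algebra K A] {a b x y : A}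

theorem mul_pow_of_qcomm {q : K} (h : x * a = q • (a * x)) (k : ℕ) :
    x * a ^ k = q ^ k • (a ^ k * x) := by
  induction k with
  | zero => simp
  | succ k ih =>
    rw [pow_succ, ← mul_assoc, ih, smul_mul_assoc, mul_assoc, h, mul_smul_comm, smul_smul,
      ← pow_succ, mul_assoc]

/-- If `y = x + (v⁻¹ - v) a b`, where `x a = v a x` and `b y = v⁻¹ y b`, then the divided powers
of `y` expand in terms of the ordered monomials `a^k x^m b^k`. -/
theorem divided_pow_add_smul_mul (hxa : x * a = v • (a * x)) (hby : b * y = v⁻¹ • (y * b))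
    (hy : y = x + (v⁻¹ - v) • (a * b)) (N : ℕ) :
    (qfact N)⁻¹ • y ^ N = ∑ p ∈ Finset.HasAntidiagonal.antidiagonal N,
      (barCoeff p.1 * (qfact p.2)⁻¹) • (a ^ p.1 * x ^ p.2 * b ^ p.1) := by
  induction N with
  | zero => simp [barCoeff, qfact]
  | succ N ih =>
    have hq : qint (N + 1) ≠ 0 := qint_ne_zero N.succ_ne_zero
    refine smul_right_injective A hq ?_
    have hleft : qint (N + 1) • (qfact (N + 1))⁻¹ • y ^ (N + 1) =
        x * ((qfact N)⁻¹ • y ^ N) +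
          ((v⁻¹ - v) * v⁻¹ ^ N) • (a * ((qfact N)⁻¹ • y ^ N) * b) := by
      rw [smul_smul, qint_succ_mul_qfact_succ_inv, pow_succ']
      nth_rewrite 1 [hy]
      rw [add_mul, smul_mul_assoc, mul_assoc a b, mul_pow_of_qcomm hby]
      simp only [mul_smul_comm, smul_mul_assoc, smul_add, smul_smul, mul_assoc]
      congr 2
      ring
    have hsplit : ∀ p ∈ Finset.HasAntidiagonal.antidiagonal (N + 1),
        qint (N + 1) • (barCoeff p.1 * (qfact p.2)⁻¹) • (a ^ p.1 * x ^ p.2 * b ^ p.1) =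
          (v ^ p.1 * barCoeff p.1 * (qint p.2 * (qfact p.2)⁻¹)) •
            (a ^ p.1 * x ^ p.2 * b ^ p.1) +
          (v⁻¹ ^ p.2 * (qint p.1 * barCoeff p.1) * (qfact p.2)⁻¹) •
            (a ^ p.1 * x ^ p.2 * b ^ p.1) := by
      intro p hp
      rw [← Finset.HasAntidiagonal.mem_antidiagonal.mp hp, qint_add, smul_smul, ← add_smul]
      congr 1
      ring
    change qint (N + 1) • (qfact (N + 1))⁻¹ • y ^ (N + 1) = qint (N + 1) • _
    rw [hleft, ih, Finset.smul_sum, Finset.sum_congr rfl hsplit, Finset.sum_add_distrib,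
      Finset.Nat.sum_antidiagonal_succ', Finset.Nat.sum_antidiagonal_succ]
    simp only [qint_zero, zero_mul, mul_zero, zero_smul, zero_add,
      qint_succ_mul_qfact_succ_inv, qint_succ_mul_barCoeff_succ]
    rw [Finset.mul_sum, Finset.mul_sum, Finset.sum_mul, Finset.smul_sum]
    congr 1
    · refine Finset.sum_congr rfl fun p _ => ?_
      rw [mul_smul_comm, ← mul_assoc, ← mul_assoc, mul_pow_of_qcomm hxa, smul_mul_assoc,
        smul_mul_assoc, smul_smul, pow_succ' x, ← mul_assoc]
      congr 1
      ring
    · refine Finset.sum_congr rfl fun p hp => ?_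
      rw [← Finset.HasAntidiagonal.mem_antidiagonal.mp hp, mul_smul_comm, smul_mul_assoc, smul_smul,
        pow_succ' a, pow_succ b]
      simp only [mul_assoc]
      congr 1
      ring

end QCommutation

theorem E_serre {n i j : ℕ} (hi : 1 ≤ i) (hin : i ≤ n) (hj : 1 ≤ j) (hjn : j ≤ n)
    (h : i + 1 = j ∨ j + 1 = i) :
    E n i ^ 2 * E n j + E n j * E n i ^ 2 = (v + v⁻¹) • (E n i * E n j * E n i) := by
  have hi' : i - 1 < n ∧ 1 ≤ i := ⟨by omega, hi⟩
  have hj' : j - 1 < n ∧ 1 ≤ j := ⟨by omega, hj⟩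
  have hrel := RingQuot.mkAlgHom_rel K
    (SerreRel.serre (n := n) ⟨i - 1, hi'.1⟩ ⟨j - 1, hj'.1⟩ (by dsimp only; omega))
  simp only [map_add, map_mul, map_pow, map_smul] at hrel
  simpa only [E, dif_pos hi', dif_pos hj'] using hrel

theorem Ebr_mul_E {n i : ℕ} (hi : 1 ≤ i) (hin : i + 1 ≤ n) :
    Ebr n i * E n i = v • (E n i * Ebr n i) := by
  have h := E_serre (n := n) (j := i + 1) hi (by omega) (by omega) hin (.inl rfl)
  have h' := eq_sub_of_add_eq' h
  rw [pow_two] at h'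
  simp only [Ebr, sub_mul, mul_sub, smul_mul_assoc, mul_smul_comm, smul_sub, smul_smul,
    mul_inv_cancel₀ v_ne_zero, mul_assoc, one_smul, add_smul] at h' ⊢
  rw [h']
  abel

theorem E_succ_mul_bar_Ebr {n i : ℕ} (hi : 1 ≤ i) (hin : i + 1 ≤ n) :
    E n (i + 1) * (E n (i + 1) * E n i - v • (E n i * E n (i + 1))) =
      v⁻¹ • ((E n (i + 1) * E n i - v • (E n i * E n (i + 1))) * E n (i + 1)) := by
  have h := E_serre (n := n) (i := i + 1) (j := i) (by omega) hin hi (by omega) (.inr rfl)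
  have h' := eq_sub_of_add_eq h
  rw [pow_two] at h'
  simp only [sub_mul, mul_sub, smul_mul_assoc, mul_smul_comm, smul_sub, smul_smul,
    inv_mul_cancel₀ v_ne_zero, mul_assoc, one_smul, add_smul] at h' ⊢
  rw [h']
  abel

/-- for the bar involution `σ` of `U` (a ring endomorphism fixing the
generators `E_1, …, E_n` and acting on scalars via the `ℚ`-algebra automorphism of
`K = ℚ(v)` sending `v` to `v⁻¹`), one has, for `1 ≤ i ≤ n - 1` and `N ∈ ℕ`:
`σ(E_{i,i+1}^{(N)}) = Σ_{k=0}^{N} v^{-k(k-1)/2} [k]_v! (v⁻¹ - v)^k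
  E_i^{(k)} E_{i,i+1}^{(N-k)} E_{i+1}^{(k)}`. -/
theorem stmt18 (n : ℕ) (hn : 2 ≤ n)
    (bar : K →ₐ[ℚ] K) (hbar : bar v = v⁻¹)
    (σ : Uq n →+* Uq n)
    (hσE : ∀ j : ℕ, 1 ≤ j → j ≤ n → σ (E n j) = E n j)
    (hσc : ∀ c : K, σ (algebraMap K (Uq n) c) = algebraMap K (Uq n) (bar c))
    (i : ℕ) (hi : 1 ≤ i) (hi' : i ≤ n - 1) (N : ℕ) :
    σ (dp n (Ebr n i) N) =
    ∑ k ∈ Finset.range (N + 1),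
      (v ^ (-((k * (k - 1) / 2 : ℕ) : ℤ)) * qfact k * (v⁻¹ - v) ^ k) •
        (dp n (E n i) k * dp n (Ebr n i) (N - k) * dp n (E n (i + 1)) k) := by
  have hin : i + 1 ≤ n := by omega
  have hσsmul (c : K) (u : Uq n) : σ (c • u) = bar c • σ u := by
    rw [Algebra.smul_def, map_mul, hσc, ← Algebra.smul_def]
  have hσx : σ (Ebr n i) = E n (i + 1) * E n i - v • (E n i * E n (i + 1)) := by
    rw [Ebr, map_sub, hσsmul, map_mul, map_mul, hσE i hi (by omega),
      hσE (i + 1) (by omega) hin, map_inv₀, hbar, inv_inv]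
  have hadd : σ (Ebr n i) = Ebr n i + (v⁻¹ - v) • (E n i * E n (i + 1)) := by
    rw [hσx, Ebr]
    exact sub_smul_eq_sub_smul_add (A := Uq n) _ _ _ _
  have hb : E n (i + 1) * σ (Ebr n i) = v⁻¹ • (σ (Ebr n i) * E n (i + 1)) := by
    rw [hσx]
    exact E_succ_mul_bar_Ebr hi hin
  rw [dp, hσsmul, map_pow, map_inv₀, bar_qfact bar hbar,
    divided_pow_add_smul_mul (Ebr_mul_E hi hin) hb hadd,
    Finset.Nat.sum_antidiagonal_eq_sum_range_succ_mk]
  refine Finset.sum_congr rfl fun k _ => ?_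
  simp only [dp, barCoeff, smul_mul_assoc, mul_smul_comm, smul_smul]
  congr 1
  field_simp [qfact_ne_zero]

end
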